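/- Singleton bound for pure entanglement-assisted codes. Let q ≥ 2, K ≥ 1, 2 ≤ d ≤ n, and let ψ be a pure quantum state on R ⊗ A_f ⊗ X_1 ⊗ … ⊗ X_n ⊗ B_in, where R has dimension K, each X_i has dimension q, and the marginal of ψ on R is the maximally mixed state (1/K)·Id_K. Suppose (purity) that S(X_J)_ψ = (d−1)·log q for every subset J ⊆ {1,…,n} with |J| = d−1, and (decodability) that for every partition {1,…,n} = I ∪ J with |I| = n−d+1 and |J| = d−1, S(X_I B_in)_ψ = S(R)_ψ + S(A_f)_ψ + S(X_J)_ψ. Then log K ≤ (n−2d+2)·log q + ℓ, where ℓ := S(B_in)_ψ − S(A_f)_ψ. -/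

import Mathlib

open scoped BigOperators ComplexOrder

/-- Von Neumann entropy of a matrix: `-∑ λ_j log λ_j` over the eigenvalues,
if the matrix is Hermitian (else junk value 0). Natural logarithm,
with the convention `0 * log 0 = 0` (automatic since `Real.log 0 = 0`). -/
noncomputable def vnEntropy {m : Type*} [Fintype m] [DecidableEq m]
    (ρ : Matrix m m ℂ) : ℝ :=
  if h : ρ.IsHermitian then
    -∑ j, h.eigenvalues j * Real.log (h.eigenvalues j)
  else 0

/-- Marginal (partial trace) of a state on the composite system
`⨂_{i : ι} X_i` (with `X_i = ℂ^{dim i}`), keeping the factors in `S`. -/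
noncomputable def marginal {ι : Type*} [Fintype ι] [DecidableEq ι]
    {dim : ι → ℕ}
    (ρ : Matrix ((i : ι) → Fin (dim i)) ((i : ι) → Fin (dim i)) ℂ)
    (S : Finset ι) :
    Matrix ((i : {j : ι // j ∈ S}) → Fin (dim i.1))
           ((i : {j : ι // j ∈ S}) → Fin (dim i.1)) ℂ :=
  fun x y =>
    ∑ z : (i : {j : ι // j ∉ S}) → Fin (dim i.1),
      ρ (fun i => if h : i ∈ S then x ⟨i, h⟩ else z ⟨i, h⟩)
        (fun i => if h : i ∈ S then y ⟨i, h⟩ else z ⟨i, h⟩)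

/-- Entropy of the marginal of `ρ` on the factors in `S`. -/
noncomputable def mEnt {ι : Type*} [Fintype ι] [DecidableEq ι]
    {dim : ι → ℕ}
    (ρ : Matrix ((i : ι) → Fin (dim i)) ((i : ι) → Fin (dim i)) ℂ)
    (S : Finset ι) : ℝ :=
  vnEntropy (marginal ρ S)


theorem vnEntropy_eq_sum {m : Type*} [Fintype m] [DecidableEq m]
    {ρ : Matrix m m ℂ} (h : ρ.IsHermitian) :
    vnEntropy ρ = ∑ j, Real.negMulLog (h.eigenvalues j) := by
  rw [vnEntropy, dif_pos h]
  simp [Real.negMulLog]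

/-- entropy is at most the Shannon entropy of the diagonal in any orthonormal basis -/
theorem vnEntropy_le_diag {m k : Type*} [Fintype m] [DecidableEq m] [Fintype k] [DecidableEq k]
    {ρ : Matrix m m ℂ} (h : ρ.PosSemidef) (W : Matrix m k ℂ)
    (h1 : W * W.conjTranspose = 1) (h2 : W.conjTranspose * W = 1) :
    vnEntropy ρ ≤ ∑ j, Real.negMulLog ((W.conjTranspose * ρ * W) j j).re := by
  have hH := h.1
  rw [vnEntropy_eq_sum hH]
  set U : Matrix m m ℂ := (hH.eigenvectorUnitary : Matrix m m ℂ) with hU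
  have hU1 : U * U.conjTranspose = 1 := by
    have := Unitary.mul_star_self_of_mem hH.eigenvectorUnitary.2
    simpa [Matrix.star_eq_conjTranspose] using this
  have hU2 : U.conjTranspose * U = 1 := by
    have := Unitary.star_mul_self_of_mem hH.eigenvectorUnitary.2
    simpa [Matrix.star_eq_conjTranspose] using this
  have hsp : ρ = U * Matrix.diagonal (fun i => (hH.eigenvalues i : ℂ)) * U.conjTranspose := by
    have := hH.spectral_theorem
    rw [Unitary.conjStarAlgAut_apply] at this
    simpa [Matrix.star_eq_conjTranspose, Function.comp_def] using this
  set M : Matrix k m ℂ := W.conjTranspose * U with hM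
  have hM1 : M * M.conjTranspose = 1 := by
    rw [hM, Matrix.conjTranspose_mul, Matrix.conjTranspose_conjTranspose, Matrix.mul_assoc,
      ← Matrix.mul_assoc U, hU1, Matrix.one_mul, h2]
  have hM2 : M.conjTranspose * M = 1 := by
    rw [hM, Matrix.conjTranspose_mul, Matrix.conjTranspose_conjTranspose, Matrix.mul_assoc,
      ← Matrix.mul_assoc W, h1, Matrix.one_mul, hU2]
  have hrow : ∀ j, ∑ i, Complex.normSq (M j i) = 1 := by
    intro j
    have := congrFun (congrFun hM1 j) j
    simp only [Matrix.mul_apply, Matrix.conjTranspose_apply, Matrix.one_apply_eq,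
      Complex.star_def, Complex.mul_conj] at this
    exact_mod_cast this
  have hcol : ∀ i, ∑ j, Complex.normSq (M j i) = 1 := by
    intro i
    have := congrFun (congrFun hM2 i) i
    simp only [Matrix.mul_apply, Matrix.conjTranspose_apply, Matrix.one_apply_eq,
      Complex.star_def, mul_comm ((starRingEnd ℂ) _), Complex.mul_conj] at this
    exact_mod_cast this
  have hdiag : ∀ j, ((W.conjTranspose * ρ * W) j j).re
      = ∑ i, Complex.normSq (M j i) * hH.eigenvalues i := by
    intro j
    have e : W.conjTranspose * ρ * W
        = M * Matrix.diagonal (fun i => (hH.eigenvalues i : ℂ)) * M.conjTranspose := by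
      conv_lhs => rw [hsp]
      rw [hM, Matrix.conjTranspose_mul, Matrix.conjTranspose_conjTranspose]
      simp only [Matrix.mul_assoc]
    rw [e, Matrix.mul_apply]
    simp only [Matrix.mul_diagonal, Matrix.conjTranspose_apply, Complex.star_def]
    rw [Complex.re_sum]
    refine Finset.sum_congr rfl fun i _ => ?_
    rw [mul_right_comm, Complex.mul_conj, ← Complex.ofReal_mul, Complex.ofReal_re]
  calc ∑ i, Real.negMulLog (hH.eigenvalues i)
      = ∑ i, ∑ j, Complex.normSq (M j i) * Real.negMulLog (hH.eigenvalues i) := by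
        refine Finset.sum_congr rfl fun i _ => ?_
        rw [← Finset.sum_mul, hcol, one_mul]
    _ = ∑ j, ∑ i, Complex.normSq (M j i) * Real.negMulLog (hH.eigenvalues i) := Finset.sum_comm
    _ ≤ _ := by
        refine Finset.sum_le_sum fun j _ => ?_
        rw [hdiag]
        have := Real.concaveOn_negMulLog.le_map_sum (t := Finset.univ)
          (w := fun i => Complex.normSq (M j i)) (p := fun i => hH.eigenvalues i)
          (fun i _ => Complex.normSq_nonneg _) (hrow j)
          (fun i _ => h.eigenvalues_nonneg i)
        simpa [smul_eq_mul] using this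

theorem sum_negMulLog_le {A : Type*} [Fintype A] [Nonempty A] (r : A → ℝ) (hr : ∀ a, 0 ≤ r a) :
    ∑ a, Real.negMulLog (r a) ≤
      Real.negMulLog (∑ a, r a) + (∑ a, r a) * Real.log (Fintype.card A) := by
  have hN : (0 : ℝ) < Fintype.card A := by exact_mod_cast Fintype.card_pos
  have := Real.concaveOn_negMulLog.le_map_sum (t := Finset.univ)
    (w := fun _ : A => (Fintype.card A : ℝ)⁻¹) (p := r)
    (fun i _ => by positivity) (by simp [hN.ne'])
    (fun i _ => hr i)
  simp only [smul_eq_mul] at this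
  rw [← Finset.mul_sum, ← Finset.mul_sum] at this
  have h2 : Real.negMulLog ((Fintype.card A : ℝ)⁻¹ * ∑ a, r a) =
      (Fintype.card A : ℝ)⁻¹ *
        (Real.negMulLog (∑ a, r a) + (∑ a, r a) * Real.log (Fintype.card A)) := by
    rw [Real.negMulLog_mul]
    simp only [Real.negMulLog, Real.log_inv]
    ring
  rw [h2] at this
  exact le_of_mul_le_mul_left this (by positivity)

theorem vnEntropy_le_add {m A B : Type*} [Fintype m] [DecidableEq m] [Fintype A] [DecidableEq A]
    [Fintype B] [DecidableEq B] [Nonempty A]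
    {ρ : Matrix m m ℂ} (h : ρ.PosSemidef) (htr : ρ.trace = 1) (e : m ≃ A × B)
    {σ : Matrix B B ℂ} (hσ : σ.IsHermitian)
    (hm : ∀ b b', σ b b' = ∑ a, ρ (e.symm (a, b)) (e.symm (a, b'))) :
    vnEntropy ρ ≤ vnEntropy σ + Real.log (Fintype.card A) := by
  set V : Matrix B B ℂ := (hσ.eigenvectorUnitary : Matrix B B ℂ) with hV
  have hV1 : V * V.conjTranspose = 1 := by
    have := Unitary.mul_star_self_of_mem hσ.eigenvectorUnitary.2
    simpa [Matrix.star_eq_conjTranspose] using this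
  have hV2 : V.conjTranspose * V = 1 := by
    have := Unitary.star_mul_self_of_mem hσ.eigenvectorUnitary.2
    simpa [Matrix.star_eq_conjTranspose] using this
  have hsp : σ = V * Matrix.diagonal (fun i => (hσ.eigenvalues i : ℂ)) * V.conjTranspose := by
    have := hσ.spectral_theorem
    rw [Unitary.conjStarAlgAut_apply] at this
    simpa [Matrix.star_eq_conjTranspose, Function.comp_def] using this
  set X : Matrix (A × B) (A × B) ℂ := Matrix.kroneckerMap (fun x y => x * y) (1 : Matrix A A ℂ) V with hX
  have hXc : X.conjTranspose = Matrix.kroneckerMap (fun x y => x * y) (1 : Matrix A A ℂ) V.conjTranspose := by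
    rw [hX, Matrix.conjTranspose_kronecker, Matrix.conjTranspose_one]
  have hX1 : X * X.conjTranspose = 1 := by
    rw [hXc, hX, ← Matrix.mul_kronecker_mul, hV1, one_mul, Matrix.one_kronecker_one]
  have hX2 : X.conjTranspose * X = 1 := by
    rw [hXc, hX, ← Matrix.mul_kronecker_mul, hV2, one_mul, Matrix.one_kronecker_one]
  set W : Matrix m (A × B) ℂ := X.submatrix e id with hW
  have hW1 : W * W.conjTranspose = 1 := by
    have : W * W.conjTranspose = (X * X.conjTranspose).submatrix e e := by
      ext x y; simp [hW, Matrix.mul_apply]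
    rw [this, hX1, Matrix.submatrix_one_equiv]
  have hW2 : W.conjTranspose * W = 1 := by
    rw [← hX2]
    ext x y
    simp only [hW, Matrix.mul_apply, Matrix.conjTranspose_apply, Matrix.submatrix_apply, id]
    exact e.sum_comp (fun z => star (X z x) * X z y)
  have hD : W.conjTranspose * ρ * W = X.conjTranspose * ρ.submatrix e.symm e.symm * X := by
    ext x y
    simp only [hW, Matrix.mul_apply, Matrix.conjTranspose_apply, Matrix.submatrix_apply, id]
    rw [← e.symm.sum_comp]
    refine Finset.sum_congr rfl fun z _ => ?_
    rw [← e.symm.sum_comp]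
    simp
  have hpos : ∀ k, 0 ≤ ((W.conjTranspose * ρ * W) k k).re := by
    intro k
    have := (h.conjTranspose_mul_mul_same W).diag_nonneg (i := k)
    exact (Complex.le_def.1 this).1
  have hsum : ∀ b, ∑ a, ((W.conjTranspose * ρ * W) (a, b) (a, b)).re = hσ.eigenvalues b := by
    intro b
    have e1 : (V.conjTranspose * σ * V) b b = hσ.eigenvalues b := by
      have : V.conjTranspose * σ * V = Matrix.diagonal (fun i => (hσ.eigenvalues i : ℂ)) := by
        conv_lhs => rw [hsp]
        calc _ = (V.conjTranspose * V) * Matrix.diagonal (fun i => (hσ.eigenvalues i : ℂ))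
            * (V.conjTranspose * V) := by simp only [Matrix.mul_assoc]
          _ = _ := by rw [hV2, one_mul, mul_one]
      rw [this]; simp
    have e2 : ∑ a, (W.conjTranspose * ρ * W) (a, b) (a, b) = (V.conjTranspose * σ * V) b b := by
      rw [hD, hXc, hX]
      simp only [Matrix.mul_apply, Fintype.sum_prod_type, Matrix.kronecker_apply,
        Matrix.submatrix_apply, Matrix.one_apply, ite_mul, one_mul, zero_mul, mul_ite, mul_zero,
        Finset.sum_ite_irrel, Finset.sum_const_zero, Finset.sum_ite_eq, Finset.sum_ite_eq',
        Finset.mem_univ, if_true, hm, Finset.sum_mul, Finset.mul_sum]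
      rw [Finset.sum_comm]
      refine Finset.sum_congr rfl fun z _ => ?_
      rw [Finset.sum_comm]
    rw [← Complex.re_sum, e2, e1, Complex.ofReal_re]
  have htot : ∑ b, hσ.eigenvalues b = 1 := by
    have h1 : σ.trace = 1 := by
      rw [← htr, Matrix.trace, Matrix.trace]
      simp only [Matrix.diag_apply, hm]
      rw [Finset.sum_comm, ← e.symm.sum_comp, Fintype.sum_prod_type]
    rw [hσ.trace_eq_sum_eigenvalues] at h1
    have h2 := congrArg Complex.re h1
    simpa using h2
  refine (vnEntropy_le_diag h W hW1 hW2).trans ?_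
  rw [Fintype.sum_prod_type, Finset.sum_comm, vnEntropy_eq_sum hσ]
  calc _ ≤ ∑ b, (Real.negMulLog (hσ.eigenvalues b)
        + hσ.eigenvalues b * Real.log (Fintype.card A)) := by
        refine Finset.sum_le_sum fun b _ => ?_
        have := sum_negMulLog_le (fun a => ((W.conjTranspose * ρ * W) (a, b) (a, b)).re)
          (fun a => hpos _)
        rwa [hsum] at this
    _ = _ := by rw [Finset.sum_add_distrib, ← Finset.sum_mul, htot, one_mul]

theorem marginal_posSemidef {ι : Type*} [Fintype ι] [DecidableEq ι] {dim : ι → ℕ}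
    {ρ : Matrix ((i : ι) → Fin (dim i)) ((i : ι) → Fin (dim i)) ℂ} (h : ρ.PosSemidef)
    (S : Finset ι) : (marginal ρ S).PosSemidef := by
  have : marginal ρ S = ∑ z : (i : {j : ι // j ∉ S}) → Fin (dim i.1),
      ρ.submatrix (fun x i => if h : i ∈ S then x ⟨i, h⟩ else z ⟨i, h⟩)
        (fun x i => if h : i ∈ S then x ⟨i, h⟩ else z ⟨i, h⟩) := by
    ext x y
    simp [marginal, Matrix.sum_apply]
  rw [this]
  exact Matrix.posSemidef_sum _ fun z _ => h.submatrix _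

theorem marginal_trace {ι : Type*} [Fintype ι] [DecidableEq ι] {dim : ι → ℕ}
    (ρ : Matrix ((i : ι) → Fin (dim i)) ((i : ι) → Fin (dim i)) ℂ)
    (S : Finset ι) : (marginal ρ S).trace = ρ.trace := by
  simp only [Matrix.trace, Matrix.diag_apply, marginal]
  rw [← (Equiv.piEquivPiSubtypeProd (fun i => i ∈ S) (fun i => Fin (dim i))).symm.sum_comp,
    Fintype.sum_prod_type]
  rfl

/-- splitting of indices over a disjoint union -/
def splitEquiv {ι : Type*} [DecidableEq ι] {dim : ι → ℕ} (S T : Finset ι) (hd : Disjoint S T) :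
    ((i : {j : ι // j ∈ S ∪ T}) → Fin (dim i.1)) ≃
      ((i : {j : ι // j ∈ S}) → Fin (dim i.1)) × ((i : {j : ι // j ∈ T}) → Fin (dim i.1)) where
  toFun x := (fun i => x ⟨i.1, Finset.mem_union_left _ i.2⟩,
    fun i => x ⟨i.1, Finset.mem_union_right _ i.2⟩)
  invFun p := fun i => if h : i.1 ∈ S then p.1 ⟨i.1, h⟩ else
    p.2 ⟨i.1, (Finset.mem_union.1 i.2).resolve_left h⟩
  left_inv x := by
    funext i
    by_cases h : i.1 ∈ S <;> simp [h]
  right_inv p := by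
    ext i
    · simp [i.2]
    · have : i.1 ∉ S := fun h => Finset.disjoint_left.1 hd h i.2
      simp [this]

/-- splitting of the complement of `T` -/
def splitCompl {ι : Type*} [DecidableEq ι] {dim : ι → ℕ} (S T : Finset ι) (hd : Disjoint S T) :
    ((i : {j : ι // j ∉ T}) → Fin (dim i.1)) ≃
      ((i : {j : ι // j ∈ S}) → Fin (dim i.1)) ×
        ((i : {j : ι // j ∉ S ∪ T}) → Fin (dim i.1)) where
  toFun x := (fun i => x ⟨i.1, Finset.disjoint_left.1 hd i.2⟩,
    fun i => x ⟨i.1, fun h => i.2 (Finset.mem_union_right _ h)⟩)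
  invFun p := fun i => if h : i.1 ∈ S then p.1 ⟨i.1, h⟩ else
    p.2 ⟨i.1, fun h' => (Finset.mem_union.1 h').elim h i.2⟩
  left_inv x := by
    funext i
    by_cases h : i.1 ∈ S <;> simp [h]
  right_inv p := by
    ext i
    · simp [i.2]
    · have : i.1 ∉ S := fun h => i.2 (Finset.mem_union_left _ h)
      simp [this]

theorem marginal_marginal {ι : Type*} [Fintype ι] [DecidableEq ι] {dim : ι → ℕ}
    (ρ : Matrix ((i : ι) → Fin (dim i)) ((i : ι) → Fin (dim i)) ℂ)
    (S T : Finset ι) (hd : Disjoint S T) (b b' : (i : {j : ι // j ∈ T}) → Fin (dim i.1)) :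
    marginal ρ T b b' = ∑ a, marginal ρ (S ∪ T) ((splitEquiv S T hd).symm (a, b))
      ((splitEquiv S T hd).symm (a, b')) := by
  simp only [marginal]
  rw [← (splitCompl S T hd).symm.sum_comp, Fintype.sum_prod_type]
  refine Finset.sum_congr rfl fun a _ => Finset.sum_congr rfl fun w _ => ?_
  have key : ∀ b : (i : {j : ι // j ∈ T}) → Fin (dim i.1),
      (fun i : ι => (if h : i ∈ T then b ⟨i, h⟩ else (splitCompl S T hd).symm (a, w) ⟨i, h⟩ :
        Fin (dim i)))
      = (fun i : ι => (if h : i ∈ S ∪ T then (splitEquiv S T hd).symm (a, b) ⟨i, h⟩ else w ⟨i, h⟩ :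
        Fin (dim i))) := by
    intro b
    funext i
    by_cases hT : i ∈ T
    · have hS : i ∉ S := fun h => Finset.disjoint_left.1 hd h hT
      simp [hT, hS, splitEquiv]
    · by_cases hS : i ∈ S <;> simp [hT, hS, splitEquiv, splitCompl]
  rw [key b, key b']

theorem mEnt_union_le {ι : Type*} [Fintype ι] [DecidableEq ι] {dim : ι → ℕ}
    {ρ : Matrix ((i : ι) → Fin (dim i)) ((i : ι) → Fin (dim i)) ℂ} (h : ρ.PosSemidef)
    (htr : ρ.trace = 1) (S T : Finset ι) (hd : Disjoint S T) :
    mEnt ρ (S ∪ T) ≤ mEnt ρ T + Real.log (∏ i ∈ S, dim i : ℕ) := by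
  have hne : Nonempty ((i : ι) → Fin (dim i)) := by
    by_contra hc
    rw [not_nonempty_iff] at hc
    simp [Matrix.trace] at htr
  obtain ⟨x0⟩ := hne
  haveI : Nonempty ((i : {j : ι // j ∈ S}) → Fin (dim i.1)) := ⟨fun i => x0 i.1⟩
  have := vnEntropy_le_add (marginal_posSemidef h (S ∪ T))
    ((marginal_trace ρ (S ∪ T)).trans htr) (splitEquiv S T hd)
    (marginal_posSemidef h T).1 (marginal_marginal ρ S T hd)
  have hc : Fintype.card ((i : {j : ι // j ∈ S}) → Fin (dim i.1)) = ∏ i ∈ S, dim i := by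
    rw [Fintype.card_pi]
    simp only [Fintype.card_fin]
    exact Finset.prod_coe_sort S dim
  rw [hc] at this
  exact this

theorem vnEntropy_smul_one {m : Type*} [Fintype m] [DecidableEq m] (K : ℕ) (hK : 1 ≤ K)
    (hc : Fintype.card m = K) :
    vnEntropy ((K : ℂ)⁻¹ • (1 : Matrix m m ℂ)) = Real.log K := by
  have hH : ((K : ℂ)⁻¹ • (1 : Matrix m m ℂ)).IsHermitian := by
    unfold Matrix.IsHermitian
    rw [Matrix.conjTranspose_smul, Matrix.conjTranspose_one]
    simp
  have he : ∀ j, hH.eigenvalues j = (K : ℝ)⁻¹ := by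
    intro j
    have h1 := hH.mulVec_eigenvectorBasis j
    have h2 : hH.eigenvectorBasis j ≠ 0 := hH.eigenvectorBasis.orthonormal.ne_zero j
    have h3 : ∃ i, (hH.eigenvectorBasis j) i ≠ 0 := by
      by_contra hcon
      push Not at hcon
      exact h2 (by ext i; simpa using hcon i)
    obtain ⟨i, hi⟩ := h3
    have h4 := congrFun h1 i
    rw [Matrix.smul_mulVec, Matrix.one_mulVec] at h4
    simp only [Pi.smul_apply, smul_eq_mul, Complex.real_smul] at h4
    have h5 := mul_right_cancel₀ hi h4
    have h6 := congrArg Complex.re h5.symm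
    have h7 : ((K : ℂ)⁻¹).re = (K : ℝ)⁻¹ := by
      rw [← Complex.ofReal_natCast, ← Complex.ofReal_inv, Complex.ofReal_re]
    exact h6.trans h7
  rw [vnEntropy_eq_sum hH]
  have : (K : ℝ) ≠ 0 := by positivity
  simp [he, hc, Real.negMulLog, this]

/-- Singleton bound for pure entanglement-assisted codes:
`log K ≤ (n-2d+2) log q + ℓ`.
Systems: `R = Sum.inr 0`, `A_f = Sum.inr 1`, `B_in = Sum.inr 2`. -/
theorem ea_singleton_pure_codes
    (n d q K : ℕ) (hq : 2 ≤ q) (hK : 1 ≤ K) (hd : 2 ≤ d) (hdn : d ≤ n)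
    (dim : Fin n ⊕ Fin 3 → ℕ)
    (hdimX : ∀ i : Fin n, dim (Sum.inl i) = q)
    (hdimR : dim (Sum.inr 0) = K)
    (ψ : Matrix ((i : Fin n ⊕ Fin 3) → Fin (dim i))
                ((i : Fin n ⊕ Fin 3) → Fin (dim i)) ℂ)
    (hpsd : ψ.PosSemidef) (htr : ψ.trace = 1) (hpure : ψ.rank = 1)
    (hmaxmix : marginal ψ ({Sum.inr 0} : Finset (Fin n ⊕ Fin 3)) = (K : ℂ)⁻¹ • 1)
    (hpurity : ∀ J : Finset (Fin n), J.card = d - 1 →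
      mEnt ψ (J.image Sum.inl) = ((d : ℝ) - 1) * Real.log q)
    (hdec : ∀ I J : Finset (Fin n), Disjoint I J → I ∪ J = Finset.univ →
      I.card = n - d + 1 → J.card = d - 1 →
      mEnt ψ (I.image Sum.inl ∪ ({Sum.inr 2} : Finset (Fin n ⊕ Fin 3))) =
        mEnt ψ ({Sum.inr 0} : Finset (Fin n ⊕ Fin 3)) + mEnt ψ ({Sum.inr 1} : Finset (Fin n ⊕ Fin 3)) + mEnt ψ (J.image Sum.inl)) :
    Real.log K ≤ ((n : ℝ) - 2 * d + 2) * Real.log q + (mEnt ψ ({Sum.inr 2} : Finset (Fin n ⊕ Fin 3)) - mEnt ψ ({Sum.inr 1} : Finset (Fin n ⊕ Fin 3))) := by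
  have hR : mEnt ψ ({Sum.inr 0} : Finset (Fin n ⊕ Fin 3)) = Real.log K := by
    rw [mEnt, hmaxmix]
    apply vnEntropy_smul_one K hK
    rw [Fintype.card_pi]
    simp only [Fintype.card_fin]
    rw [Finset.prod_coe_sort ({Sum.inr 0} : Finset (Fin n ⊕ Fin 3)) dim, Finset.prod_singleton,
      hdimR]
  obtain ⟨J, hJ⟩ := Finset.exists_subset_card_eq (s := (Finset.univ : Finset (Fin n)))
    (n := d - 1) (by simp; omega)
  have hJc := hJ.2
  have hIc : (Jᶜ).card = n - d + 1 := by
    rw [Finset.card_compl, hJc, Fintype.card_fin]; omega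
  have h1 := hdec Jᶜ J disjoint_compl_left (by rw [Finset.union_comm]; simp) hIc hJc
  rw [hR, hpurity J hJc] at h1
  have h2 := mEnt_union_le hpsd htr (Finset.image Sum.inl Jᶜ)
    ({Sum.inr 2} : Finset (Fin n ⊕ Fin 3)) (by simp)
  have h3 : ∏ i ∈ Finset.image (Sum.inl : Fin n → Fin n ⊕ Fin 3) Jᶜ, dim i = q ^ (n - d + 1) := by
    rw [Finset.prod_image (fun _ _ _ _ h => Sum.inl_injective h)]
    simp only [hdimX]
    rw [Finset.prod_const, hIc]
  rw [h3] at h2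
  push_cast [Real.log_pow, Nat.cast_sub hdn] at h2
  rw [h1] at h2
  linarith
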